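/- Let V be a type of propositional variables, F a set of clauses over V, and L = [ℓ₁, …, ℓₙ] a finite list of literals containing no literal together with its negation. Let Dec be a subset of the literals occurring in L (the decisions), and suppose that for every index i, either ℓᵢ ∈ Dec, or there exists a clause R ∈ F that is unit in ℓᵢ under the set {ℓ₁, …, ℓ_{i-1}}. If some clause C ∈ F is falsified by the set {ℓ₁, …, ℓₙ}, then F entails the clause {¬d : d ∈ Dec}. (Soundness of conflict-driven clause learning.) -/

import Mathlib

/-- A literal is a variable paired with a Boolean polarity. -/
abbrev Lit (V : Type*) := V × Bool

/-- Negation of a literal flips its polarity. -/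
def NegLit {V : Type*} (l : Lit V) : Lit V := (l.1, !l.2)

/-- A clause is a finite set of literals. -/
abbrev Clause (V : Type*) := Finset (Lit V)

/-- A total assignment satisfies a literal `(x, b)` iff it maps `x` to `b`. -/
def SatLit {V : Type*} (v : V → Bool) (l : Lit V) : Prop := v l.1 = l.2

/-- A total assignment satisfies a clause iff it satisfies some literal of it. -/
def SatClause {V : Type*} (v : V → Bool) (C : Clause V) : Prop := ∃ l ∈ C, SatLit v l

/-- A set of clauses entails a clause iff every assignment satisfying all
clauses of the set satisfies the clause. -/
def Entails {V : Type*} (F : Set (Clause V)) (C : Clause V) : Prop :=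
  ∀ v : V → Bool, (∀ D ∈ F, SatClause v D) → SatClause v C

/-- A clause is falsified by a set `π` of literals if the negation of every
literal of the clause belongs to `π`. -/
def Falsified {V : Type*} (π : Set (Lit V)) (C : Clause V) : Prop :=
  ∀ l ∈ C, NegLit l ∈ π

/-- A clause `C` is unit in `ℓ` under a set `π` of literals if `ℓ ∈ C`, the
negation of `ℓ` is not in `π`, and the negation of every literal of `C \ {ℓ}`
is in `π`. -/
def UnitIn {V : Type*} [DecidableEq V] (π : Set (Lit V)) (C : Clause V) (ℓ : Lit V) : Prop :=
  ℓ ∈ C ∧ NegLit ℓ ∉ π ∧ ∀ m ∈ C \ {ℓ}, NegLit m ∈ π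

/-- Negated literals are satisfied exactly when the literal is not. -/
theorem satLit_negLit_iff {V : Type*} (v : V → Bool) (l : Lit V) :
    SatLit v (NegLit l) ↔ ¬ SatLit v l := by
  simp only [SatLit, NegLit]
  cases v l.1 <;> cases l.2 <;> simp

/-- A satisfied clause is not falsified by a set of satisfied literals. -/
theorem not_falsified_of_satClause {V : Type*} {v : V → Bool} {π : Set (Lit V)} {C : Clause V}
    (hπ : ∀ l ∈ π, SatLit v l) (hC : SatClause v C) : ¬ Falsified π C := by
  obtain ⟨l, hl, hv⟩ := hC
  exact fun h => (satLit_negLit_iff v l).1 (hπ _ (h l hl)) hv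

/-- Unit propagation preserves satisfaction. -/
theorem UnitIn.satLit {V : Type*} [DecidableEq V] {v : V → Bool} {π : Set (Lit V)}
    {C : Clause V} {l : Lit V} (h : UnitIn π C l) (hπ : ∀ m ∈ π, SatLit v m)
    (hC : SatClause v C) : SatLit v l := by
  obtain ⟨m, hm, hv⟩ := hC
  by_cases hml : m = l
  · exact hml ▸ hv
  · have hneg := hπ _ (h.2.2 m (by simp [hm, hml]))
    exact absurd hv ((satLit_negLit_iff v m).1 hneg)

/-- An assignment satisfying the clauses and the decisions satisfies the whole trail. -/
theorem satLit_of_mem_trail {V : Type*} [DecidableEq V] {F : Set (Clause V)} {L : List (Lit V)}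
    {Dec : Finset (Lit V)}
    (hstep : ∀ i : Fin L.length,
      L.get i ∈ Dec ∨ ∃ R ∈ F, UnitIn {l | l ∈ L.take i} R (L.get i))
    {v : V → Bool} (hF : ∀ D ∈ F, SatClause v D) (hDec : ∀ d ∈ Dec, SatLit v d) :
    ∀ l ∈ L, SatLit v l := by
  have key : ∀ n (hn : n < L.length), SatLit v (L.get ⟨n, hn⟩) := by
    intro n
    induction n using Nat.strong_induction_on with
    | _ n ih =>
      intro hn
      rcases hstep ⟨n, hn⟩ with hd | ⟨R, hR, hunit⟩
      · exact hDec _ hd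
      · refine hunit.satLit (fun m hm => ?_) (hF R hR)
        obtain ⟨j, hj, rfl⟩ := List.mem_take_iff_getElem.1 hm
        exact ih j (lt_of_lt_of_le hj (min_le_left _ _)) (lt_of_lt_of_le hj (min_le_right _ _))
  intro l hl
  obtain ⟨i, rfl⟩ := List.get_of_mem hl
  exact key i i.2

/-- Soundness of conflict-driven clause learning: if a trail `L` contains no
literal together with its negation, every literal of `L` is either a decision
(in `Dec`, a subset of the literals of `L`) or implied by a clause of `F` that
is unit under the preceding literals, and some clause of `F` is falsified by
the literals of `L`, then `F` entails the clause of negated decisions. -/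
theorem cdcl_learning_sound {V : Type*} [DecidableEq V]
    (F : Set (Clause V)) (L : List (Lit V))
    (hcons : ∀ l ∈ L, NegLit l ∉ L)
    (Dec : Finset (Lit V)) (hDec : ∀ d ∈ Dec, d ∈ L)
    (hstep : ∀ i : Fin L.length,
      L.get i ∈ Dec ∨ ∃ R ∈ F, UnitIn {l | l ∈ L.take i} R (L.get i))
    (C : Clause V) (hC : C ∈ F) (hfals : Falsified {l | l ∈ L} C) :
    Entails F (Dec.image NegLit) := by
  intro v hF
  by_contra hsat
  refine not_falsified_of_satClause (satLit_of_mem_trail hstep hF fun d hd => ?_) (hF C hC) hfals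
  by_contra hv
  exact hsat ⟨NegLit d, Finset.mem_image_of_mem NegLit hd, (satLit_negLit_iff v d).2 hv⟩
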